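/- arXiv:1503.05398 — 3 statements merged into one kernel-verified Lean document; each statement's English description precedes it below -/
import Mathlib

section
/- For every n-tuple t = (t_1,…,t_n) of positive integers there exists a partition I ∪ J = {1,…,n} with I nonempty such that (t_{i₁}+2+log₂ n)/𝔮 < t_{i₂} < 𝔮·t_{i₁} − (2+log₂ n) for all i₁, i₂ ∈ I, and 𝔮·t_j − (2+log₂ n) ≤ t_ι for all j ∈ J, where t_ι = max{t_i : i ∈ I}. -/
open Finset

/-- Hypothesis (H): some `t_i > (2 + 2log₂ n)/(𝔮 − 1)`. -/
def HypH {n : ℕ} (𝔮 : ℝ) (t : Fin n → ℕ) : Prop :=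
  ∃ i : Fin n, (2 + 2 * Real.logb 2 n) / (𝔮 - 1) < (t i : ℝ)

/-- (Lemma 3.2) For every `n`-tuple `t` of positive integers (satisfying (H))
there is a partition `I ∪ J = {1,…,n}` with `I` nonempty such that
`(t_{i₁}+2+log₂ n)/𝔮 < t_{i₂} < 𝔮·t_{i₁} − (2+log₂ n)` for all `i₁, i₂ ∈ I`, and
`𝔮·t_j − (2+log₂ n) ≤ t_ι` for all `j ∈ J`, where `t_ι = max{t_i : i ∈ I}`. -/
theorem statement2 {n : ℕ} (hn : 1 ≤ n) (ρ : ℝ) (hρ0 : 0 < ρ) (hρ1 : ρ < 1)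
    (𝔮 : ℝ) (h𝔮 : 𝔮 = 1 / ρ)
    (t : Fin n → ℕ) (ht : ∀ i, 1 ≤ t i) (hH : HypH 𝔮 t) :
    ∃ I J : Finset (Fin n), Disjoint I J ∧ I ∪ J = Finset.univ ∧ I.Nonempty ∧
      (∀ i₁ ∈ I, ∀ i₂ ∈ I,
        ((t i₁ : ℝ) + 2 + Real.logb 2 n) / 𝔮 < (t i₂ : ℝ) ∧
        (t i₂ : ℝ) < 𝔮 * (t i₁ : ℝ) - (2 + Real.logb 2 n)) ∧
      ∃ ι ∈ I, (∀ i ∈ I, t i ≤ t ι) ∧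
        ∀ j ∈ J, 𝔮 * (t j : ℝ) - (2 + Real.logb 2 n) ≤ (t ι : ℝ) := by
  have hlog : 0 ≤ Real.logb 2 n :=
    Real.logb_nonneg one_lt_two (by exact_mod_cast hn)
  have hq : 1 < 𝔮 := by rw [h𝔮]; exact one_lt_one_div hρ0 hρ1
  obtain ⟨k, hk⟩ := hH
  obtain ⟨ι, -, hmax⟩ := Finset.exists_max_image Finset.univ t ⟨k, Finset.mem_univ k⟩
  have hle (i : Fin n) : (t i : ℝ) ≤ t ι := by exact_mod_cast hmax i (Finset.mem_univ i)
  have hι : (t ι : ℝ) < 𝔮 * (t ι : ℝ) - (2 + Real.logb 2 n) := by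
    have := (div_lt_iff₀ (sub_pos.2 hq)).1 (hk.trans_le (hle k))
    linarith
  let I : Finset (Fin n) :=
    Finset.univ.filter fun i => (t ι : ℝ) < 𝔮 * (t i : ℝ) - (2 + Real.logb 2 n)
  have hI (i : Fin n) : i ∈ I ↔ (t ι : ℝ) < 𝔮 * (t i : ℝ) - (2 + Real.logb 2 n) := by
    simp [I]
  refine ⟨I, Iᶜ, disjoint_compl_right, Finset.union_compl I, ⟨ι, (hI ι).2 hι⟩,
    fun i₁ h₁ i₂ h₂ => ⟨?_, (hle i₂).trans_lt ((hI i₁).1 h₁)⟩,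
    ι, (hI ι).2 hι, fun i _ => hmax i (Finset.mem_univ i), fun j hj => ?_⟩
  · rw [div_lt_iff₀ (by linarith)]
    linarith [hle i₁, (hI i₂).1 h₂]
  · rw [Finset.mem_compl, hI] at hj
    exact not_lt.1 hj
end

section
/- There are constants c₁ > 0 and C (depending only on Φ₀, K, C₀, d) such that for every δ ∈ (0,1) and every x_o ∈ ℝ^d, the region of influence B*_δ = ⋃_{s : 2^{−s} ≤ δ} ⋃_ν R^ν_s has Lebesgue measure at most C·δ. -/
open MeasureTheory Real Finset
open scoped RealInnerProductSpace ENNReal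

noncomputable section

abbrev Euc (d : ℕ) : Type := EuclideanSpace ℝ (Fin d)

/-- Build a Euclidean vector from coordinates. -/
def eVec {d : ℕ} (f : Fin d → ℝ) : Euc d := (EuclideanSpace.equiv (Fin d) ℝ).symm f

/-- The gradient `∇_ξΦ₀(x,ξ)` in the frequency variable. -/
def gradXi {d : ℕ} (Φ₀ : Euc d → Euc d → ℝ) (x ξ : Euc d) : Euc d :=
  eVec (fun k => fderiv ℝ (fun ξ' => Φ₀ x ξ') ξ (EuclideanSpace.single k 1))

/-- The mixed Hessian `(∂²Φ₀/∂x_j∂ξ_k)_{j,k}`. -/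
def mixedHess0 {d : ℕ} (Φ₀ : Euc d → Euc d → ℝ) (x ξ : Euc d) : Matrix (Fin d) (Fin d) ℝ :=
  fun j k => fderiv ℝ (fun x' => fderiv ℝ (fun ξ' => Φ₀ x' ξ') ξ (EuclideanSpace.single k 1))
    x (EuclideanSpace.single j 1)

/-- The gradient in the frequency variable is `C¹` away from zero frequency. -/
theorem contDiffAt_gradXi {d : ℕ} {Φ₀ : Euc d → Euc d → ℝ}
    (hsm : ContDiffOn ℝ (⊤ : ℕ∞) (fun p : Euc d × Euc d => Φ₀ p.1 p.2)
      {p : Euc d × Euc d | p.2 ≠ 0})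
    {x ξ : Euc d} (hξ : ξ ≠ 0) :
    ContDiffAt ℝ 1 (fun p : Euc d × Euc d => gradXi Φ₀ p.1 p.2) (x, ξ) := by
  have hopen : IsOpen {p : Euc d × Euc d | p.2 ≠ 0} := isOpen_ne_fun continuous_snd continuous_const
  have hΦ : ∀ p : Euc d × Euc d, p.2 ≠ 0 →
      ContDiffAt ℝ (⊤ : ℕ∞) (fun p : Euc d × Euc d => Φ₀ p.1 p.2) p := fun p hp =>
    hsm.contDiffAt (hopen.mem_nhds hp)
  have hcoord : ∀ k : Fin d, ContDiffAt ℝ 1 (fun p : Euc d × Euc d =>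
      fderiv ℝ (fun ξ' => Φ₀ p.1 ξ') p.2 (EuclideanSpace.single k 1)) (x, ξ) := by
    intro k
    have hd : ContDiffAt ℝ 1 (fun p => fderiv ℝ (fun p : Euc d × Euc d => Φ₀ p.1 p.2) p
        (0, EuclideanSpace.single k 1)) (x, ξ) :=
      ((hΦ (x, ξ) hξ).fderiv_right (m := 1) (by norm_cast)).clm_apply
        contDiffAt_const
    refine hd.congr_of_eventuallyEq ?_
    filter_upwards [hopen.mem_nhds (show (x, ξ) ∈ _ from hξ)] with p hp
    have h := ((hΦ p hp).differentiableAt (by simp)).hasFDerivAt.comp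
      (f := fun ξ' => (p.1, ξ')) p.2 (hasFDerivAt_prodMk_right p.1 p.2)
    have h' : fderiv ℝ (fun ξ' => Φ₀ p.1 ξ') p.2 = _ := h.fderiv
    rw [h']
    simp
  exact (EuclideanSpace.equiv (Fin d) ℝ).symm.contDiff.contDiffAt.comp _ (contDiffAt_pi.2 hcoord)

/-- The partial derivative in `x` of the frequency gradient is invertible where the mixed Hessian
is nondegenerate. -/
theorem det_fderiv_gradXi_ne_zero {d : ℕ} {Φ₀ : Euc d → Euc d → ℝ} {x ξ : Euc d}
    {A : Euc d →L[ℝ] Euc d} (hA : HasFDerivAt (fun x' => gradXi Φ₀ x' ξ) A x)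
    (hdet : (mixedHess0 Φ₀ x ξ).det ≠ 0) : A.det ≠ 0 := by
  have hM : mixedHess0 Φ₀ x ξ = (LinearMap.toMatrix (EuclideanSpace.basisFun (Fin d) ℝ).toBasis
      (EuclideanSpace.basisFun (Fin d) ℝ).toBasis (A : Euc d →ₗ[ℝ] Euc d)).transpose := by
    ext j k
    have h : HasFDerivAt
        (fun x' => fderiv ℝ (fun ξ' => Φ₀ x' ξ') ξ (EuclideanSpace.single k 1))
        ((EuclideanSpace.proj k : Euc d →L[ℝ] ℝ).comp A) x :=
      (EuclideanSpace.proj k : Euc d →L[ℝ] ℝ).hasFDerivAt.comp x hA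
    simp [mixedHess0, h.fderiv, LinearMap.toMatrix_apply]
  rw [hM, Matrix.det_transpose, LinearMap.det_toMatrix] at hdet
  exact hdet

/-- Preimages under `x ↦ ∇_ξΦ₀(x,ξ)` have volume controlled uniformly for `(x,ξ)` in a compact
set on which the mixed Hessian is nondegenerate. -/
theorem exists_volume_preimage_gradXi_le {d : ℕ} {Φ₀ : Euc d → Euc d → ℝ}
    (hsm : ContDiffOn ℝ (⊤ : ℕ∞) (fun p : Euc d × Euc d => Φ₀ p.1 p.2)
      {p : Euc d × Euc d | p.2 ≠ 0})
    {T : Set (Euc d × Euc d)} (hT : IsCompact T)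
    (hnd : ∀ p ∈ T, p.2 ≠ 0 ∧ (mixedHess0 Φ₀ p.1 p.2).det ≠ 0) :
    ∃ A : NNReal, ∀ (ξ : Euc d) (B : Set (Euc d)),
      volume {x | (x, ξ) ∈ T ∧ gradXi Φ₀ x ξ ∈ B} ≤ A * volume B := by
  refine hT.induction_on (p := fun T => ∃ A : NNReal, ∀ (ξ : Euc d) (B : Set (Euc d)),
      volume {x | (x, ξ) ∈ T ∧ gradXi Φ₀ x ξ ∈ B} ≤ A * volume B) ⟨0, by simp⟩ ?_ ?_ ?_
  · rintro S T hST ⟨A, hA⟩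
    exact ⟨A, fun ξ B => (measure_mono fun x hx => And.intro (hST hx.1) hx.2).trans (hA ξ B)⟩
  · rintro S T ⟨A, hA⟩ ⟨A', hA'⟩
    refine ⟨A + A', fun ξ B => ?_⟩
    calc _ ≤ volume ({x | (x, ξ) ∈ S ∧ gradXi Φ₀ x ξ ∈ B} ∪
          {x | (x, ξ) ∈ T ∧ gradXi Φ₀ x ξ ∈ B}) := measure_mono fun x hx =>
            hx.1.imp (And.intro · hx.2) (And.intro · hx.2)
      _ ≤ A * volume B + A' * volume B := (measure_union_le _ _).trans
            (add_le_add (hA ξ B) (hA' ξ B))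
      _ = _ := by push_cast; ring
  · rintro ⟨x₀, ξ₀⟩ hp
    obtain ⟨hξ₀, hdet⟩ := hnd _ hp
    have hG := (contDiffAt_gradXi hsm (x := x₀) hξ₀).hasStrictFDerivAt (by simp)
    set G' := fderiv ℝ (fun p : Euc d × Euc d => gradXi Φ₀ p.1 p.2) (x₀, ξ₀)
    set A : Euc d →L[ℝ] Euc d := G'.comp (ContinuousLinearMap.inl ℝ _ _) with hAdef
    have hA : A.det ≠ 0 := det_fderiv_gradXi_ne_zero
      (hG.hasFDerivAt.comp (f := fun x => (x, ξ₀)) x₀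
        (hasFDerivAt_prodMk_left x₀ ξ₀)) hdet
    obtain ⟨m, hm0, hm⟩ := exists_between
      (show (0 : ENNReal) < ENNReal.ofReal |A.det| by simpa using hA)
    lift m to NNReal using (hm.trans ENNReal.ofReal_lt_top).ne
    obtain ⟨ε, hε, hε0⟩ := ((mul_le_addHaar_image_of_lt_det volume A hm).and
      self_mem_nhdsWithin).exists
    obtain ⟨W, hW, hWapp⟩ := hG.approximates_deriv_on_nhds (c := ε) (Or.inr hε0)
    refine ⟨W, mem_nhdsWithin_of_mem_nhds hW, m⁻¹, fun ξ B => ?_⟩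
    have happ : ApproximatesLinearOn (fun x => gradXi Φ₀ x ξ) A
        {x | (x, ξ) ∈ W ∧ gradXi Φ₀ x ξ ∈ B} ε := by
      intro x hx y hy
      have h := hWapp (x, ξ) hx.1 (y, ξ) hy.1
      simpa [hAdef, Prod.norm_def, ← map_sub, sub_sub_sub_comm] using h
    have h := (hε _ _ happ).trans (measure_mono (Set.image_subset_iff.2 fun x hx => hx.2))
    have hm0' : m ≠ 0 := by simpa using hm0.ne'
    rw [ENNReal.coe_inv hm0', mul_comm, ← div_eq_mul_inv]
    exact (ENNReal.le_div_iff_mul_le (Or.inl (by simpa using hm0')) (Or.inl (by simp))).2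
      (by rwa [mul_comm])

/-- A ball of radius `a` intersected with a slab of width `b` has volume `O(a ^ (d - 1) * b)`. -/
theorem volume_plate_le {d : ℕ} (hd : 0 < d) {ν : Euc d} (hν : ‖ν‖ = 1) (x₀ : Euc d) {a b : ℝ}
    (ha : 0 ≤ a) (hb : 0 ≤ b) :
    volume {y : Euc d | ‖x₀ - y‖ ≤ a ∧ |⟪x₀ - y, ν⟫| ≤ b} ≤
      ENNReal.ofReal (2 * b * (2 * a) ^ (d - 1)) := by
  let i₀ : Fin d := ⟨0, hd⟩
  obtain ⟨e, he⟩ := Orthonormal.exists_orthonormalBasis_extension_of_card_eq (𝕜 := ℝ) (E := Euc d)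
    (ι := Fin d) (by simp) (v := fun _ => ν) (s := {i₀})
    ⟨fun _ => hν, fun i j hij => (hij (Subsingleton.elim i j)).elim⟩
  replace he : e i₀ = ν := he i₀ rfl
  let r : Fin d → ℝ := Function.update (fun _ => a) i₀ b
  let L : Euc d → Fin d → ℝ := fun y => (EuclideanSpace.equiv (Fin d) ℝ) (e.repr (x₀ - y))
  have hL : MeasurePreserving L volume volume :=
    (PiLp.volume_preserving_ofLp (Fin d)).comp
      (e.measurePreserving_repr.comp (volume.measurePreserving_sub_left x₀))
  calc _ ≤ volume (L ⁻¹' Set.Icc (-r) r) := by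
        refine measure_mono fun y hy => ?_
        have hle : ∀ i, |L y i| ≤ r i := by
          intro i
          have hi : L y i = ⟪e i, x₀ - y⟫ := e.repr_apply_apply _ _
          rw [hi]
          by_cases h : i = i₀
          · subst h
            simpa [r, he, real_inner_comm] using hy.2
          · have := (abs_real_inner_le_norm (e i) (x₀ - y)).trans (by simpa using hy.1)
            simpa [r, h] using this
        exact ⟨fun i => (abs_le.1 (hle i)).1, fun i => (abs_le.1 (hle i)).2⟩
    _ = volume (Set.Icc (-r) r) := hL.measure_preimage measurableSet_Icc.nullMeasurableSet
    _ = _ := by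
        rw [Real.volume_Icc_pi, ← ENNReal.ofReal_prod_of_nonneg]
        · congr 1
          rw [← Finset.mul_prod_erase _ _ (Finset.mem_univ i₀), Finset.prod_congr rfl
            (g := fun _ => 2 * a)]
          · simp [r, two_mul, Finset.card_erase_of_mem]
          · intro i hi
            simp [r, Finset.ne_of_mem_erase hi, two_mul]
        · intro i _
          by_cases h : i = i₀
          · subst h; simpa [r] using hb
          · simpa [r, h] using ha

/-- There are constants `c₁ > 0` and `C` such that for every `δ ∈ (0,1)` and
every `x_o ∈ ℝ^d`, the region of influence `B*_δ = ⋃_{s : 2^{−s} ≤ δ} ⋃_ν R^ν_s` has Lebesgue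
measure at most `C·δ`. -/
theorem statement11 {d : ℕ} (hd : 2 ≤ d) (Φ₀ : Euc d → Euc d → ℝ)
    (hsm : ContDiffOn ℝ (⊤ : ℕ∞) (fun p : Euc d × Euc d => Φ₀ p.1 p.2)
      {p : Euc d × Euc d | p.2 ≠ 0})
    (hhom : ∀ c : ℝ, 0 < c → ∀ x ξ, Φ₀ x (c • ξ) = c * Φ₀ x ξ)
    (K : Set (Euc d)) (hK : IsCompact K)
    (hnd : ∀ x ∈ K, ∀ ξ : Euc d, ξ ≠ 0 → (mixedHess0 Φ₀ x ξ).det ≠ 0)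
    (C₀ : ℝ) (pts : ℕ → Finset (Euc d))
    (hpts : ∀ s : ℕ, 1 ≤ s → (∀ ν ∈ pts s, ‖ν‖ = 1) ∧
      ((pts s).card : ℝ) ≤ C₀ * (2 : ℝ) ^ ((s : ℝ) * ((d : ℝ) - 1) / 2)) :
    ∃ c₁ C : ℝ, 0 < c₁ ∧ ∀ δ : ℝ, 0 < δ → δ < 1 → ∀ x_o : Euc d,
      volume {x : Euc d | ∃ s : ℕ, 1 ≤ s ∧ (2 : ℝ) ^ (-(s : ℝ)) ≤ δ ∧
          ∃ ν ∈ pts s, x ∈ K ∧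
            ‖x_o - gradXi Φ₀ x ν‖ ≤ c₁ * (2 : ℝ) ^ (-(s : ℝ) / 2) ∧
            |⟪x_o - gradXi Φ₀ x ν, ν⟫| ≤ c₁ * (2 : ℝ) ^ (-(s : ℝ))} ≤
        ENNReal.ofReal (C * δ) := by
  have hd0 : 0 < d := by omega
  obtain ⟨A, hA⟩ := exists_volume_preimage_gradXi_le hsm
    (T := K ×ˢ Metric.sphere (0 : Euc d) 1) (hK.prod (isCompact_sphere 0 1)) (by
      rintro ⟨x, ξ⟩ ⟨hx, hξ⟩
      have hξ0 : ξ ≠ 0 := ne_zero_of_mem_unit_sphere ⟨ξ, hξ⟩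
      exact ⟨hξ0, hnd x hx ξ hξ0⟩)
  have hC₀ : 0 ≤ C₀ := nonneg_of_mul_nonneg_left
    ((Nat.cast_nonneg _).trans (hpts 1 le_rfl).2) (by positivity)
  set M : ℝ := C₀ * (A * 2 ^ d)
  refine ⟨1, 2 * M, one_pos, fun δ hδ hδ1 x_o => ?_⟩
  have hscale : ∀ s : ℕ, (2 : ℝ) ^ (-(s : ℝ)) = (1 / 2) ^ s := fun s => by
    rw [rpow_neg zero_le_two, rpow_natCast, one_div, inv_pow]
  let R : ℕ → Euc d → Set (Euc d) := fun s ν => {x | (x, ν) ∈ K ×ˢ Metric.sphere (0 : Euc d) 1 ∧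
    gradXi Φ₀ x ν ∈ {y | ‖x_o - y‖ ≤ (2 : ℝ) ^ (-(s : ℝ) / 2) ∧
      |⟪x_o - y, ν⟫| ≤ (2 : ℝ) ^ (-(s : ℝ))}}
  have hscales : ∀ s : ℕ, 1 ≤ s →
      volume (⋃ ν ∈ pts s, R s ν) ≤ ENNReal.ofReal (M * (1 / 2) ^ s) := by
    intro s hs
    obtain ⟨hnorm, hcard⟩ := hpts s hs
    set b : ℝ := (2 : ℝ) ^ (-(s : ℝ))
    set a : ℝ := (2 : ℝ) ^ (-(s : ℝ) / 2)
    have hpow : (2 : ℝ) ^ ((s : ℝ) * ((d : ℝ) - 1) / 2) * a ^ (d - 1) = 1 := by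
      rw [← rpow_natCast a, ← rpow_mul zero_le_two, ← rpow_add two_pos, Nat.cast_pred hd0]
      ring_nf
      exact rpow_zero 2
    calc volume (⋃ ν ∈ pts s, R s ν) ≤ ∑ ν ∈ pts s, volume (R s ν) :=
          measure_biUnion_finset_le _ _
      _ ≤ ∑ ν ∈ pts s, ENNReal.ofReal (A * (2 * b * (2 * a) ^ (d - 1))) := by
          refine Finset.sum_le_sum fun ν hν => (hA ν _).trans ?_
          rw [ENNReal.ofReal_mul A.coe_nonneg, ENNReal.ofReal_coe_nnreal]
          gcongr
          exact volume_plate_le hd0 (hnorm ν hν) x_o (by positivity) (by positivity)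
      _ = ENNReal.ofReal ((pts s).card * (A * (2 * b * (2 * a) ^ (d - 1)))) := by
          rw [Finset.sum_const, nsmul_eq_mul, ENNReal.ofReal_mul (Nat.cast_nonneg _),
            ENNReal.ofReal_natCast]
      _ ≤ ENNReal.ofReal (C₀ * (2 : ℝ) ^ ((s : ℝ) * ((d : ℝ) - 1) / 2) *
            (A * (2 * b * (2 * a) ^ (d - 1)))) := by gcongr
      _ = ENNReal.ofReal (M * (1 / 2) ^ s) := by
          congr 1
          rw [← hscale s, mul_pow]
          calc _ = C₀ * (A * (2 * 2 ^ (d - 1))) * b *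
                ((2 : ℝ) ^ ((s : ℝ) * ((d : ℝ) - 1) / 2) * a ^ (d - 1)) := by ring
            _ = _ := by rw [hpow, mul_one, mul_pow_sub_one hd0.ne']
  have hex : ∃ n : ℕ, ((1 : ℝ) / 2) ^ n ≤ δ :=
    (exists_pow_lt_of_lt_one hδ (by norm_num)).imp fun _ => le_of_lt
  obtain ⟨n, hn, hmin⟩ : ∃ n : ℕ, ((1 : ℝ) / 2) ^ n ≤ δ ∧
      ∀ s : ℕ, ((1 : ℝ) / 2) ^ s ≤ δ → n ≤ s := by
    classical exact ⟨Nat.find hex, Nat.find_spec hex, fun _ => Nat.find_min' hex⟩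
  have hn1 : 1 ≤ n := by
    by_contra! h
    rw [Nat.lt_one_iff.1 h, pow_zero] at hn
    linarith
  calc _ ≤ volume (⋃ k : ℕ, ⋃ ν ∈ pts (n + k), R (n + k) ν) := by
        refine measure_mono ?_
        rintro x ⟨s, hs, hsδ, ν, hν, hx, h1, h2⟩
        have hns : n ≤ s := hmin s (by rwa [← hscale s])
        obtain ⟨k, rfl⟩ := Nat.exists_eq_add_of_le hns
        rw [one_mul] at h1 h2
        simp only [Set.mem_iUnion]
        exact ⟨k, ν, hν, ⟨hx, by simpa using (hpts _ hs).1 ν hν⟩, h1, h2⟩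
    _ ≤ ∑' k : ℕ, ENNReal.ofReal (M * (1 / 2) ^ (n + k)) :=
        (measure_iUnion_le _).trans (ENNReal.tsum_le_tsum fun k => hscales _ (by omega))
    _ = ENNReal.ofReal (2 * M * (1 / 2) ^ n) := by
        have hsum : HasSum (fun k : ℕ => M * (1 / 2 : ℝ) ^ (n + k)) (2 * M * (1 / 2) ^ n) := by
          rw [mul_comm 2 M, mul_right_comm]
          simpa only [pow_add, ← mul_assoc] using
            hasSum_geometric_two.mul_left (M * (1 / 2 : ℝ) ^ n)
        rw [← ENNReal.ofReal_tsum_of_nonneg (fun k => by positivity) hsum.summable, hsum.tsum_eq]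
    _ ≤ ENNReal.ofReal (2 * M * δ) := by gcongr

end
end

section
/- For every integer N₀ ≥ 1 there is a constant A_{N₀} (independent of s and e) such that for all x ∈ K, all integers s ≥ 1, all unit vectors e ∈ S^{d−1}, and all ξ with 2^{s−1} ≤ |ξ| ≤ 2^{s+1} and |ξ/|ξ| − e| ≤ 2·2^{−s/2}, one has |(∂/∂τ)^{N₀} φ(x,ξ)| ≤ A_{N₀}·2^{−N₀ s} and |∇_η^{N₀} φ(x,ξ)| ≤ A_{N₀}·2^{−N₀ s/2}. -/
open MeasureTheory Real Finset
open scoped RealInnerProductSpace ENNReal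

noncomputable section

/-- Iterated directional derivative along the list of directions `vs`. -/
def itD {d : ℕ} (vs : List (Euc d)) (f : Euc d → ℝ) : Euc d → ℝ :=
  vs.foldr (fun v g => fun ξ => fderiv ℝ g ξ v) f

section IteratedDirectionalDerivative

variable {d : ℕ} {f : Euc d → ℝ}

lemma itD_cons (v : Euc d) (vs : List (Euc d)) (f : Euc d → ℝ) (ξ : Euc d) :
    itD (v :: vs) f ξ = fderiv ℝ (itD vs f) ξ v := rfl

lemma itD_append (us vs : List (Euc d)) (f : Euc d → ℝ) :
    itD (us ++ vs) f = itD us (itD vs f) := by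
  simp [itD, List.foldr_append]

lemma isOpen_punctured : IsOpen {ξ : Euc d | ξ ≠ 0} := isOpen_ne

lemma contDiffOn_itD (hf : ContDiffOn ℝ (⊤ : ℕ∞) f {ξ | ξ ≠ 0}) (vs : List (Euc d)) :
    ContDiffOn ℝ (⊤ : ℕ∞) (itD vs f) {ξ | ξ ≠ 0} := by
  induction vs with
  | nil => exact hf
  | cons v vs ih =>
    exact (ih.fderiv_of_isOpen (m := (⊤ : ℕ∞)) isOpen_punctured (by simp)).clm_apply
      contDiffOn_const

lemma contDiffAt_itD (hf : ContDiffOn ℝ (⊤ : ℕ∞) f {ξ | ξ ≠ 0}) (vs : List (Euc d))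
    {ξ : Euc d} (hξ : ξ ≠ 0) : ContDiffAt ℝ (⊤ : ℕ∞) (itD vs f) ξ :=
  (contDiffOn_itD hf vs).contDiffAt (isOpen_punctured.mem_nhds hξ)

lemma differentiableAt_itD (hf : ContDiffOn ℝ (⊤ : ℕ∞) f {ξ | ξ ≠ 0}) (vs : List (Euc d))
    {ξ : Euc d} (hξ : ξ ≠ 0) : DifferentiableAt ℝ (itD vs f) ξ :=
  (contDiffAt_itD hf vs hξ).differentiableAt (by simp)

lemma hasDerivAt_itD_line (hf : ContDiffOn ℝ (⊤ : ℕ∞) f {ξ | ξ ≠ 0}) (vs : List (Euc d))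
    (a w : Euc d) {t : ℝ} (ht : a + t • w ≠ 0) :
    HasDerivAt (fun t : ℝ => itD vs f (a + t • w)) (itD (w :: vs) f (a + t • w)) t := by
  have hline : HasDerivAt (fun t : ℝ => a + t • w) w t := by
    simpa using ((hasDerivAt_id t).smul_const w).const_add a
  exact (differentiableAt_itD hf vs ht).hasFDerivAt.comp_hasDerivAt t hline

lemma itD_perm (hf : ContDiffOn ℝ (⊤ : ℕ∞) f {ξ | ξ ≠ 0}) {us vs : List (Euc d)}
    (h : us.Perm vs) : ∀ ξ : Euc d, ξ ≠ 0 → itD us f ξ = itD vs f ξ := by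
  induction h with
  | nil => exact fun _ _ => rfl
  | cons v _ ih =>
    intro ξ hξ
    have : itD _ f =ᶠ[nhds ξ] itD _ f :=
      Filter.eventually_of_mem (isOpen_punctured.mem_nhds hξ) ih
    rw [itD_cons, itD_cons, this.fderiv_eq]
  | swap v w l =>
    intro ξ hξ
    have hg := contDiffAt_itD hf l hξ
    have hd : DifferentiableAt ℝ (fderiv ℝ (itD l f)) ξ :=
      (hg.fderiv_right (m := 1) (WithTop.coe_le_coe.2 le_top)).differentiableAt (by simp)
    have hs : IsSymmSndFDerivAt ℝ (itD l f) ξ :=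
      hg.isSymmSndFDerivAt (by simpa using WithTop.coe_le_coe.2 (le_top : (2 : ℕ∞) ≤ ⊤))
    have key (a b : Euc d) : itD (a :: b :: l) f ξ = fderiv ℝ (fderiv ℝ (itD l f)) ξ a b := by
      change fderiv ℝ (fun ζ => fderiv ℝ (itD l f) ζ b) ξ a = _
      rw [fderiv_clm_apply hd (differentiableAt_const b)]
      simp
    rw [key, key, hs.eq]
  | trans _ _ ih₁ ih₂ => exact fun ξ hξ => (ih₁ ξ hξ).trans (ih₂ ξ hξ)

lemma itD_sub {g : Euc d → ℝ} (hf : ContDiffOn ℝ (⊤ : ℕ∞) f {ξ | ξ ≠ 0})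
    (hg : ContDiffOn ℝ (⊤ : ℕ∞) g {ξ | ξ ≠ 0}) (vs : List (Euc d)) :
    ∀ ξ : Euc d, ξ ≠ 0 → itD vs (fun ζ => f ζ - g ζ) ξ = itD vs f ξ - itD vs g ξ := by
  induction vs with
  | nil => exact fun _ _ => rfl
  | cons v vs ih =>
    intro ξ hξ
    have : itD vs (fun ζ => f ζ - g ζ) =ᶠ[nhds ξ] fun ζ => itD vs f ζ - itD vs g ζ :=
      Filter.eventually_of_mem (isOpen_punctured.mem_nhds hξ) ih
    simp only [itD_cons]
    rw [this.fderiv_eq,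
      fderiv_fun_sub (differentiableAt_itD hf vs hξ) (differentiableAt_itD hg vs hξ)]
    rfl

lemma itD_inner_singleton (a v : Euc d) : itD [v] (fun ζ => ⟪a, ζ⟫) = fun _ => ⟪a, v⟫ := by
  funext ξ
  change fderiv ℝ (innerSL ℝ a) ξ v = _
  rw [ContinuousLinearMap.fderiv]
  rfl

lemma itD_inner_eq_zero (a : Euc d) :
    ∀ vs : List (Euc d), 2 ≤ vs.length → itD vs (fun ζ => ⟪a, ζ⟫) = 0
  | [], h => by simp at h
  | [_], h => by simp at h
  | [u, v], _ => by
    funext ξ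
    rw [itD_cons, itD_inner_singleton]
    simp
  | u :: v :: w :: vs, _ => by
    funext ξ
    rw [itD_cons, itD_inner_eq_zero a (v :: w :: vs) (by simp)]
    simp

lemma itD_smul_of_homogeneous (hhom : ∀ c : ℝ, 0 < c → ∀ ξ, f (c • ξ) = c * f ξ)
    {c : ℝ} (hc : 0 < c) (vs : List (Euc d)) :
    ∀ ξ : Euc d, c ^ vs.length * itD vs f (c • ξ) = c * itD vs f ξ := by
  induction vs with
  | nil => intro ξ; simpa [itD] using hhom c hc ξ
  | cons v vs ih =>
    intro ξ
    have h : fderiv ℝ (c ^ vs.length • fun ζ => itD vs f (c • ζ)) ξ v =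
        fderiv ℝ (c • itD vs f) ξ v := congrArg (fun g => fderiv ℝ g ξ v) (funext ih)
    simp only [fderiv_const_smul_field, Pi.smul_apply, fderiv_comp_smul, _root_.smul_apply,
      smul_eq_mul] at h
    simp only [itD_cons, List.length_cons]
    rw [← h]
    ring

lemma itD_replicate_eq_zero_of_const_on_ray {k : Euc d → ℝ}
    (hk : ContDiffOn ℝ (⊤ : ℕ∞) k {ξ | ξ ≠ 0}) {e : Euc d} (he : e ≠ 0) {c : ℝ}
    (hray : ∀ t : ℝ, 0 < t → k (t • e) = c) (n : ℕ) :
    ∀ t : ℝ, 0 < t → itD (List.replicate (n + 1) e) k (t • e) = 0 := by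
  have step (m : ℕ) (b : ℝ)
      (h : ∀ t : ℝ, 0 < t → itD (List.replicate m e) k (t • e) = b) (t : ℝ) (ht : 0 < t) :
      itD (List.replicate (m + 1) e) k (t • e) = 0 := by
    have h1 := hasDerivAt_itD_line hk (List.replicate m e) 0 e (t := t) (by simp [ht.ne', he])
    simp only [zero_add] at h1
    have h2 : (fun t : ℝ => itD (List.replicate m e) k (t • e)) =ᶠ[nhds t] fun _ => b :=
      Filter.eventually_of_mem (Ioi_mem_nhds ht) h
    exact h1.unique ((hasDerivAt_const t b).congr_of_eventuallyEq h2)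
  induction n with
  | zero => exact step 0 c hray
  | succ n ih => exact step (n + 1) 0 ih

lemma itD_cons_replicate_eq_zero (hf : ContDiffOn ℝ (⊤ : ℕ∞) f {ξ | ξ ≠ 0})
    (hhom : ∀ c : ℝ, 0 < c → ∀ ξ, f (c • ξ) = c * f ξ) {e : Euc d} (he : e ≠ 0)
    (w : Euc d) (n : ℕ) : itD (w :: List.replicate (n + 1) e) f e = 0 := by
  rw [itD_perm hf (List.perm_append_singleton w (List.replicate (n + 1) e)).symm e he,
    itD_append]
  have h := itD_replicate_eq_zero_of_const_on_ray (contDiffOn_itD hf [w]) he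
    (c := itD [w] f e) (fun t ht => ?_) n 1 one_pos
  · simpa using h
  · have := itD_smul_of_homogeneous hhom ht [w] e
    simpa [ht.ne'] using this

lemma itD_eq_iteratedFDeriv {F : Euc d × Euc d → ℝ}
    (hF : ContDiffOn ℝ (⊤ : ℕ∞) F {p | p.2 ≠ 0}) (x : Euc d) (vs : List (Euc d)) :
    ∀ ξ : Euc d, ξ ≠ 0 → itD vs (fun ζ => F (x, ζ)) ξ =
      iteratedFDeriv ℝ vs.length F (x, ξ) (fun i => (0, vs.get i)) := by
  have hopen : IsOpen {p : Euc d × Euc d | p.2 ≠ 0} := isOpen_ne.preimage continuous_snd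
  induction vs with
  | nil => intro ξ _; simp [itD]
  | cons v vs ih =>
    intro ξ hξ
    have heq : itD vs (fun ζ => F (x, ζ)) =ᶠ[nhds ξ] fun ζ =>
        iteratedFDeriv ℝ vs.length F (x, ζ) (fun i => (0, vs.get i)) :=
      Filter.eventually_of_mem (isOpen_punctured.mem_nhds hξ) ih
    have hat : ContDiffAt ℝ (⊤ : ℕ∞) F (x, ξ) := hF.contDiffAt (hopen.mem_nhds hξ)
    have hdiff : DifferentiableAt ℝ (iteratedFDeriv ℝ vs.length F) (x, ξ) :=
      hat.differentiableAt_iteratedFDeriv (by exact_mod_cast WithTop.coe_lt_top _)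
    have hcomp : HasFDerivAt (fun ζ : Euc d => iteratedFDeriv ℝ vs.length F (x, ζ))
        ((fderiv ℝ (iteratedFDeriv ℝ vs.length F) (x, ξ)).comp
          (ContinuousLinearMap.inr ℝ (Euc d) (Euc d))) ξ :=
      hdiff.hasFDerivAt.comp ξ (hasFDerivAt_prodMk_right x ξ)
    have happ := (ContinuousMultilinearMap.apply ℝ (fun _ : Fin vs.length => Euc d × Euc d) ℝ
      (fun i => (0, vs.get i))).hasFDerivAt.comp ξ hcomp
    rw [itD_cons, heq.fderiv_eq]
    erw [happ.fderiv]
    simp only [List.length_cons, iteratedFDeriv_succ_apply_left]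
    rfl

lemma exists_bound_itD {F : Euc d × Euc d → ℝ}
    (hF : ContDiffOn ℝ (⊤ : ℕ∞) F {p | p.2 ≠ 0}) {K : Set (Euc d)} (hK : IsCompact K)
    (n : ℕ) :
    ∃ C : ℝ, 0 ≤ C ∧ ∀ x ∈ K, ∀ ζ : Euc d, 1 / 2 ≤ ‖ζ‖ → ‖ζ‖ ≤ 1 →
      ∀ vs : List (Euc d), vs.length = n →
        |itD vs (fun ξ => F (x, ξ)) ζ| ≤ C * (vs.map (‖·‖)).prod := by
  have hopen : IsOpen {p : Euc d × Euc d | p.2 ≠ 0} := isOpen_ne.preimage continuous_snd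
  have hcpt : IsCompact (K ×ˢ (Metric.closedBall (0 : Euc d) 1 ∩ {ζ | 1 / 2 ≤ ‖ζ‖})) :=
    hK.prod ((isCompact_closedBall 0 1).inter_right
      (isClosed_le continuous_const continuous_norm))
  have hne {ζ : Euc d} (h : 1 / 2 ≤ ‖ζ‖) : ζ ≠ 0 := by
    rintro rfl
    norm_num at h
  have hcont : ContinuousOn (iteratedFDeriv ℝ n F)
      (K ×ˢ (Metric.closedBall (0 : Euc d) 1 ∩ {ζ | 1 / 2 ≤ ‖ζ‖})) := by
    rintro ⟨x, ζ⟩ ⟨-, -, hζ⟩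
    have hat : ContDiffAt ℝ (⊤ : ℕ∞) F (x, ζ) := hF.contDiffAt (hopen.mem_nhds (hne hζ))
    exact (hat.differentiableAt_iteratedFDeriv
      (by exact_mod_cast WithTop.coe_lt_top _)).continuousAt.continuousWithinAt
  obtain ⟨C, hC⟩ := hcpt.exists_bound_of_continuousOn hcont
  refine ⟨max C 0, le_max_right _ _, ?_⟩
  rintro x hx ζ h1 h2 vs rfl
  rw [itD_eq_iteratedFDeriv hF x vs ζ (hne h1), ← Real.norm_eq_abs]
  refine (ContinuousMultilinearMap.le_opNorm _ _).trans ?_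
  have hprod : ∏ i : Fin vs.length, ‖((0 : Euc d), vs.get i)‖ = (vs.map (‖·‖)).prod := by
    simp [Prod.norm_def, ← List.prod_ofFn]
  rw [hprod]
  refine mul_le_mul_of_nonneg_right
    ((hC (x, ζ) ⟨hx, by simpa using h2, h1⟩).trans (le_max_left _ _)) ?_
  exact List.prod_nonneg (by simp)

end IteratedDirectionalDerivative

lemma inner_gradXi {d : ℕ} (Φ₀ : Euc d → Euc d → ℝ) (x e v : Euc d) :
    ⟪gradXi Φ₀ x e, v⟫ = itD [v] (Φ₀ x) e := by
  have hv : v = ∑ k, v k • EuclideanSpace.single k (1 : ℝ) := by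
    simpa using ((EuclideanSpace.basisFun (Fin d) ℝ).sum_repr v).symm
  change _ = fderiv ℝ (Φ₀ x) e v
  conv_rhs => rw [hv]
  simp [gradXi, eVec, PiLp.inner_apply]

lemma norm_segment_bounds {E : Type*} [NormedAddCommGroup E] [InnerProductSpace ℝ E] {e θ : E}
    (he : ‖e‖ = 1) (hθ : ‖θ‖ = 1) (h : ‖θ - e‖ ^ 2 ≤ 2) {t : ℝ} (ht : t ∈ Set.Icc (0 : ℝ) 1) :
    1 / 2 ≤ ‖e + t • (θ - e)‖ ∧ ‖e + t • (θ - e)‖ ≤ 1 := by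
  obtain ⟨h0, h1⟩ := ht
  have hin : ‖θ - e‖ ^ 2 = 2 - 2 * ⟪θ, e⟫ := by
    rw [norm_sub_sq_real, he, hθ]; ring
  have hp : ‖e + t • (θ - e)‖ ^ 2 = 1 - t * (1 - t) * ‖θ - e‖ ^ 2 := by
    rw [norm_add_sq_real, norm_smul, inner_smul_right, inner_sub_right, mul_pow, hin,
      real_inner_self_eq_norm_sq, he, real_inner_comm, Real.norm_eq_abs, sq_abs]
    ring
  have htt : 0 ≤ t * (1 - t) := mul_nonneg h0 (by linarith)
  have htt' : t * (1 - t) ≤ 1 / 4 := by nlinarith [sq_nonneg (t - 1 / 2)]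
  have hn := norm_nonneg (e + t • (θ - e))
  constructor
  · nlinarith [sq_nonneg ‖θ - e‖]
  · nlinarith [mul_nonneg htt (sq_nonneg ‖θ - e‖)]

section Segment

variable {d : ℕ} {f : Euc d → ℝ} {vs : List (Euc d)} {e w : Euc d} {M : ℝ}

lemma abs_itD_sub_le (hf : ContDiffOn ℝ (⊤ : ℕ∞) f {ξ | ξ ≠ 0})
    (hne : ∀ t ∈ Set.Icc (0 : ℝ) 1, e + t • w ≠ 0)
    (hM : ∀ t ∈ Set.Icc (0 : ℝ) 1, |itD (w :: vs) f (e + t • w)| ≤ M)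
    {t : ℝ} (ht : t ∈ Set.Icc (0 : ℝ) 1) :
    |itD vs f (e + t • w) - itD vs f e| ≤ M := by
  have h := norm_image_sub_le_of_norm_deriv_le_segment' (a := (0 : ℝ)) (b := 1)
    (fun t ht => (hasDerivAt_itD_line hf vs e w (hne t ht)).hasDerivWithinAt)
    (fun t ht => hM t (Set.Ico_subset_Icc_self ht)) t ht
  have hM0 : 0 ≤ M := (abs_nonneg _).trans (hM t ht)
  simp only [zero_smul, add_zero, sub_zero, Real.norm_eq_abs] at h
  exact h.trans (mul_le_of_le_one_right hM0 ht.2)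

lemma abs_itD_sub_le_of_critical (hf : ContDiffOn ℝ (⊤ : ℕ∞) f {ξ | ξ ≠ 0})
    (hne : ∀ t ∈ Set.Icc (0 : ℝ) 1, e + t • w ≠ 0) (hcrit : itD (w :: vs) f e = 0)
    (hM : ∀ t ∈ Set.Icc (0 : ℝ) 1, |itD (w :: w :: vs) f (e + t • w)| ≤ M)
    {t : ℝ} (ht : t ∈ Set.Icc (0 : ℝ) 1) :
    |itD vs f (e + t • w) - itD vs f e| ≤ M :=
  abs_itD_sub_le hf hne
    (fun t ht => by simpa [hcrit] using abs_itD_sub_le (vs := w :: vs) hf hne hM ht) ht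

end Segment

section UnitSphere

variable {d n : ℕ} {f : Euc d → ℝ} {e θ : Euc d} {C : ℝ}

lemma abs_itD_replicate_sub_le (hf : ContDiffOn ℝ (⊤ : ℕ∞) f {ξ | ξ ≠ 0})
    (hhom : ∀ c : ℝ, 0 < c → ∀ ξ, f (c • ξ) = c * f ξ)
    (hC : ∀ ζ : Euc d, 1 / 2 ≤ ‖ζ‖ → ‖ζ‖ ≤ 1 → ∀ vs : List (Euc d), vs.length = n + 3 →
      |itD vs f ζ| ≤ C * (vs.map (‖·‖)).prod)
    (he : ‖e‖ = 1) (hθ : ‖θ‖ = 1) (h : ‖θ - e‖ ^ 2 ≤ 2) :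
    |itD (List.replicate (n + 1) e) f θ - itD (List.replicate (n + 1) e) f e| ≤
      C * ‖θ - e‖ ^ 2 := by
  have hseg {t : ℝ} (ht : t ∈ Set.Icc (0 : ℝ) 1) := norm_segment_bounds he hθ h ht
  have hbound := abs_itD_sub_le_of_critical hf (w := θ - e)
    (fun t ht => norm_pos_iff.1 (one_half_pos.trans_le (hseg ht).1))
    (itD_cons_replicate_eq_zero hf hhom (norm_pos_iff.1 (he ▸ one_pos)) _ n)
    (fun t ht => hC _ (hseg ht).1 (hseg ht).2 _ (by simp)) (Set.right_mem_Icc.2 zero_le_one)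
  simpa [he, sq] using hbound

lemma abs_itD_singleton_sub_le (hf : ContDiffOn ℝ (⊤ : ℕ∞) f {ξ | ξ ≠ 0})
    (hC : ∀ ζ : Euc d, 1 / 2 ≤ ‖ζ‖ → ‖ζ‖ ≤ 1 → ∀ vs : List (Euc d), vs.length = 2 →
      |itD vs f ζ| ≤ C * (vs.map (‖·‖)).prod)
    (he : ‖e‖ = 1) (hθ : ‖θ‖ = 1) (h : ‖θ - e‖ ^ 2 ≤ 2) {v : Euc d} (hv : ‖v‖ = 1) :
    |itD [v] f θ - itD [v] f e| ≤ C * ‖θ - e‖ := by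
  have hseg {t : ℝ} (ht : t ∈ Set.Icc (0 : ℝ) 1) := norm_segment_bounds he hθ h ht
  have hbound := abs_itD_sub_le hf (vs := [v]) (w := θ - e)
    (fun t ht => norm_pos_iff.1 (one_half_pos.trans_le (hseg ht).1))
    (fun t ht => hC _ (hseg ht).1 (hseg ht).2 _ (by simp)) (Set.right_mem_Icc.2 zero_le_one)
  simpa [hv] using hbound

end UnitSphere

lemma itD_phase {d : ℕ} {Φ₀ : Euc d → Euc d → ℝ} {x : Euc d}
    (hf : ContDiffOn ℝ (⊤ : ℕ∞) (Φ₀ x) {ξ | ξ ≠ 0}) (e : Euc d) {ξ : Euc d} (hξ : ξ ≠ 0) :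
    (∀ v, itD [v] (fun ξ' => Φ₀ x ξ' - ⟪gradXi Φ₀ x e, ξ'⟫) ξ =
      itD [v] (Φ₀ x) ξ - itD [v] (Φ₀ x) e) ∧
    ∀ vs : List (Euc d), 2 ≤ vs.length →
      itD vs (fun ξ' => Φ₀ x ξ' - ⟪gradXi Φ₀ x e, ξ'⟫) ξ = itD vs (Φ₀ x) ξ := by
  have hsub (vs : List (Euc d)) := itD_sub hf (g := fun ζ => ⟪gradXi Φ₀ x e, ζ⟫)
    (innerSL ℝ (gradXi Φ₀ x e)).contDiff.contDiffOn vs ξ hξ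
  refine ⟨fun v => ?_, fun vs hvs => ?_⟩
  · rw [hsub, itD_inner_singleton, inner_gradXi]
  · rw [hsub, itD_inner_eq_zero _ vs hvs, Pi.zero_apply, sub_zero]

lemma itD_eq_of_homogeneous {d : ℕ} {f : Euc d → ℝ}
    (hhom : ∀ c : ℝ, 0 < c → ∀ ξ, f (c • ξ) = c * f ξ) {ξ : Euc d} (hξ : ξ ≠ 0)
    {vs : List (Euc d)} {n : ℕ} (hn : vs.length = n + 1) :
    ‖ξ‖ ^ n * itD vs f ξ = itD vs f (‖ξ‖⁻¹ • ξ) := by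
  have hpos : 0 < ‖ξ‖ := norm_pos_iff.2 hξ
  have h := itD_smul_of_homogeneous hhom hpos vs (‖ξ‖⁻¹ • ξ)
  rw [smul_inv_smul₀ hpos.ne', hn, pow_succ'] at h
  exact mul_left_cancel₀ hpos.ne' (by rw [← h]; ring)

lemma abs_le_of_pow_mul_le {r y M s : ℝ} {n : ℕ} (hr : (2 : ℝ) ^ (s - 1) ≤ r)
    (h : |r ^ n * y| ≤ M) : |y| ≤ 2 ^ n * M * (2 : ℝ) ^ (-(n * s)) := by
  have h2 : (0 : ℝ) < (2 : ℝ) ^ (s - 1) := by positivity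
  have hr0 : 0 < r := h2.trans_le hr
  have hpow : ((2 : ℝ) ^ (s - 1)) ^ n = (2 ^ n)⁻¹ * ((2 : ℝ) ^ (-(n * s)))⁻¹ := by
    rw [← Real.rpow_natCast, ← Real.rpow_mul zero_le_two, Real.rpow_neg zero_le_two, inv_inv,
      ← Real.rpow_natCast, ← Real.rpow_neg zero_le_two, ← Real.rpow_add two_pos]
    ring_nf
  have hle : (2 ^ n)⁻¹ * ((2 : ℝ) ^ (-(n * s)))⁻¹ * |y| ≤ M := by
    rw [← hpow]
    refine le_trans ?_ h
    rw [abs_mul, abs_of_pos (pow_pos hr0 n)]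
    gcongr
  have hb : (0 : ℝ) < (2 : ℝ) ^ (-(n * s)) := by positivity
  calc |y| = 2 ^ n * ((2 ^ n)⁻¹ * ((2 : ℝ) ^ (-(n * s)))⁻¹ * |y|) * (2 : ℝ) ^ (-(n * s)) := by
        field_simp
    _ ≤ _ := by gcongr

/-- For `φ(x,ξ) = Φ₀(x,ξ) − ∇_ξΦ₀(x,e)·ξ`, in the shell `2^{s−1} ≤ |ξ| ≤ 2^{s+1}`
and the cone `|ξ/|ξ| − e| ≤ 2·2^{−s/2}`, one has `|(∂/∂τ)^{N₀}φ| ≤ A·2^{−N₀s}` and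
`|∇_η^{N₀}φ| ≤ A·2^{−N₀s/2}`, with `A` independent of `s` and `e`. -/
theorem statement17 {d : ℕ} (hd : 2 ≤ d) (Φ₀ : Euc d → Euc d → ℝ)
    (hsm : ContDiffOn ℝ (⊤ : ℕ∞) (fun p : Euc d × Euc d => Φ₀ p.1 p.2)
      {p : Euc d × Euc d | p.2 ≠ 0})
    (hhom : ∀ c : ℝ, 0 < c → ∀ x ξ, Φ₀ x (c • ξ) = c * Φ₀ x ξ)
    (K : Set (Euc d)) (hK : IsCompact K) :
    ∀ N₀ : ℕ, 1 ≤ N₀ → ∃ A : ℝ, ∀ x ∈ K, ∀ s : ℕ, 1 ≤ s →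
      ∀ e : Euc d, ‖e‖ = 1 →
      ∀ ξ : Euc d, (2 : ℝ) ^ ((s : ℝ) - 1) ≤ ‖ξ‖ → ‖ξ‖ ≤ (2 : ℝ) ^ ((s : ℝ) + 1) →
        ‖‖ξ‖⁻¹ • ξ - e‖ ≤ 2 * (2 : ℝ) ^ (-(s : ℝ) / 2) →
      (|itD (List.replicate N₀ e)
          (fun ξ' => Φ₀ x ξ' - ⟪gradXi Φ₀ x e, ξ'⟫) ξ| ≤ A * (2 : ℝ) ^ (-((N₀ : ℝ) * s))) ∧
      ∀ vs : List (Euc d), vs.length = N₀ → (∀ v ∈ vs, ‖v‖ = 1 ∧ ⟪v, e⟫ = 0) →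
        |itD vs (fun ξ' => Φ₀ x ξ' - ⟪gradXi Φ₀ x e, ξ'⟫) ξ| ≤
          A * (2 : ℝ) ^ (-((N₀ : ℝ) * s / 2)) := by
  rintro (_ | n) hN
  · omega
  obtain ⟨C₀, hC₀, hb₀⟩ := exists_bound_itD hsm hK (n + 1)
  obtain ⟨C₁, hC₁, hb₁⟩ := exists_bound_itD hsm hK 2
  obtain ⟨C₂, hC₂, hb₂⟩ := exists_bound_itD hsm hK (n + 3)
  refine ⟨2 ^ n * (C₀ + 2 * C₁ + 4 * C₂), fun x hx s hs e he ξ hlow _ hcone => ?_⟩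
  have hs' : (1 : ℝ) ≤ s := by exact_mod_cast hs
  have hf : ContDiffOn ℝ (⊤ : ℕ∞) (Φ₀ x) {ξ | ξ ≠ 0} :=
    hsm.comp (contDiff_prodMk_right x).contDiffOn fun _ h => h
  have hhomx : ∀ c : ℝ, 0 < c → ∀ ζ, Φ₀ x (c • ζ) = c * Φ₀ x ζ := fun c hc => hhom c hc x
  have hξ : ξ ≠ 0 := norm_pos_iff.1 (lt_of_lt_of_le (by positivity) hlow)
  have hphase := itD_phase hf e hξ
  have hθ : ‖‖ξ‖⁻¹ • ξ‖ = 1 := norm_smul_inv_norm (𝕜 := ℝ) hξ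
  have hcone2 : ‖‖ξ‖⁻¹ • ξ - e‖ ^ 2 ≤ 4 * (2 : ℝ) ^ (-(s : ℝ)) := by
    calc _ ≤ (2 * (2 : ℝ) ^ (-(s : ℝ) / 2)) ^ 2 := by gcongr
      _ = _ := by
        rw [mul_pow, ← Real.rpow_natCast ((2 : ℝ) ^ (-(s : ℝ) / 2)), ← Real.rpow_mul zero_le_two]
        norm_num
  have hcone_two : ‖‖ξ‖⁻¹ • ξ - e‖ ^ 2 ≤ 2 := by
    have : (2 : ℝ) ^ (-(s : ℝ)) ≤ 2 ^ (-1 : ℝ) :=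
      Real.rpow_le_rpow_of_exponent_le one_le_two (by linarith)
    rw [Real.rpow_neg_one] at this
    linarith
  constructor
  · have hval : ‖ξ‖ ^ n * itD (List.replicate (n + 1) e)
        (fun ξ' => Φ₀ x ξ' - ⟪gradXi Φ₀ x e, ξ'⟫) ξ =
        itD (List.replicate (n + 1) e) (Φ₀ x) (‖ξ‖⁻¹ • ξ) -
          itD (List.replicate (n + 1) e) (Φ₀ x) e := by
      rw [← itD_eq_of_homogeneous hhomx hξ (List.length_replicate ..)]
      cases n with
      | zero => simpa using hphase.1 e
      | succ m =>
        rw [hphase.2 _ (by simp), List.replicate_succ,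
          itD_cons_replicate_eq_zero hf hhomx (norm_pos_iff.1 (he ▸ one_pos)), sub_zero]
    have hmain := abs_itD_replicate_sub_le hf hhomx (hb₂ x hx) he hθ hcone_two
    rw [← hval] at hmain
    refine (abs_le_of_pow_mul_le hlow
      (hmain.trans (mul_le_mul_of_nonneg_left hcone2 hC₂))).trans ?_
    have hexp : (2 : ℝ) ^ (-(((n + 1 : ℕ) : ℝ) * s)) =
        (2 : ℝ) ^ (-(s : ℝ)) * (2 : ℝ) ^ (-(n * (s : ℝ))) := by
      rw [← Real.rpow_add two_pos]
      push_cast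
      ring_nf
    rw [hexp]
    calc _ = 2 ^ n * (4 * C₂) * ((2 : ℝ) ^ (-(s : ℝ)) * (2 : ℝ) ^ (-(n * (s : ℝ)))) := by ring
      _ ≤ _ := by gcongr; linarith
  · intro vs hvs hunit
    rcases n with _ | n
    · obtain ⟨v, rfl⟩ := List.length_eq_one_iff.1 hvs
      have hmain := abs_itD_singleton_sub_le hf (hb₁ x hx) he hθ hcone_two
        (hunit v (by simp)).1
      rw [← itD_eq_of_homogeneous hhomx hξ (n := 0) hvs, pow_zero, one_mul] at hmain
      rw [hphase.1]
      refine hmain.trans ((mul_le_mul_of_nonneg_left hcone hC₁).trans ?_)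
      simp only [zero_add, Nat.cast_one, one_mul, pow_zero, neg_div]
      rw [← mul_assoc]
      gcongr
      linarith
    · have hprod : (vs.map (‖·‖)).prod = 1 :=
        List.prod_eq_one (by simpa using fun v hv => (hunit v hv).1)
      have hmain := hb₀ x hx _ (by rw [hθ]; norm_num) hθ.le vs hvs
      rw [hprod, mul_one] at hmain
      rw [hphase.2 vs (by omega)]
      rw [← itD_eq_of_homogeneous hhomx hξ hvs] at hmain
      refine (abs_le_of_pow_mul_le hlow hmain).trans ?_
      gcongr
      · linarith
      · exact one_le_two
      · push_cast
        nlinarith [mul_nonneg n.cast_nonneg (zero_le_one.trans hs' : (0 : ℝ) ≤ s)]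

end
end
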